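/- For each p ∈ (0,1), the function λ ↦ d_tv(X_{1,p}, Π_λ) is strictly decreasing in λ on the interval (0, λ*_p], where λ*_p := min(-ln(1-p), 1). -/

import Mathlib

/-- The Bernoulli(p) probability mass function on ℕ. -/
noncomputable def bernoulliPMF (p : ℝ) : ℕ → ℝ :=
  fun k => if k = 0 then 1 - p else if k = 1 then p else 0

/-- The Poisson(l) probability mass function on ℕ. -/
noncomputable def poissonPMF (l : ℝ) : ℕ → ℝ :=
  fun k => Real.exp (-l) * l ^ k / (Nat.factorial k)

/-- Total variation distance between two distributions on ℕ. -/
noncomputable def dtv (P Q : ℕ → ℝ) : ℝ := (1 / 2) * ∑' k : ℕ, |P k - Q k|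

lemma HasSum.of_forall_eq {f g : ℕ → ℝ} {a : ℝ} (hf : HasSum f a) (h : ∀ k, g k = f k) :
    HasSum g a :=
  (funext h : g = f) ▸ hf

lemma bernoulliPMF_hasSum (p : ℝ) : HasSum (bernoulliPMF p) 1 := by
  have h := (hasSum_ite_eq (0 : ℕ) (1 - p)).add (hasSum_ite_eq (1 : ℕ) p)
  rw [sub_add_cancel] at h
  refine h.of_forall_eq fun k => ?_
  by_cases h0 : k = 0
  · simp [bernoulliPMF, h0]
  · simp [bernoulliPMF, h0]

lemma poissonPMF_hasSum (l : ℝ) : HasSum (poissonPMF l) 1 := by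
  have h := (NormedSpace.expSeries_div_hasSum_exp l).mul_left (Real.exp (-l))
  rw [← Real.exp_eq_exp_ℝ, ← Real.exp_add, neg_add_cancel, Real.exp_zero] at h
  exact h.of_forall_eq fun k => mul_div_assoc _ _ _

lemma mul_exp_neg_lt_one_sub_exp_neg {l : ℝ} (hl : 0 < l) :
    l * Real.exp (-l) < 1 - Real.exp (-l) := by
  have h := mul_lt_mul_of_pos_right (Real.add_one_lt_exp hl.ne') (Real.exp_pos (-l))
  rw [← Real.exp_add, add_neg_cancel, Real.exp_zero] at h
  linarith

/-- While the Poisson mass at `0` is at least the Bernoulli one, `1` is the only atom where the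
Bernoulli mass is larger. -/
lemma dtv_bernoulliPMF_poissonPMF {p l : ℝ} (hl : 0 < l) (hpl : 1 - p ≤ Real.exp (-l)) :
    dtv (bernoulliPMF p) (poissonPMF l) = p - l * Real.exp (-l) := by
  have h := ((poissonPMF_hasSum l).sub (bernoulliPMF_hasSum p)).add
    (hasSum_ite_eq (1 : ℕ) (2 * (p - l * Real.exp (-l))))
  have h1 := mul_exp_neg_lt_one_sub_exp_neg hl
  have h2 : HasSum (fun k => |bernoulliPMF p k - poissonPMF l k|)
      (1 - 1 + 2 * (p - l * Real.exp (-l))) := by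
    refine h.of_forall_eq fun k => ?_
    match k with
    | 0 =>
      simp only [bernoulliPMF, poissonPMF]
      norm_num
      rw [abs_of_nonpos (by linarith)]
      ring
    | 1 =>
      simp only [bernoulliPMF, poissonPMF]
      norm_num
      rw [abs_of_nonneg (by linarith)]
      ring
    | k + 2 =>
      have h3 : 0 ≤ poissonPMF l (k + 2) := by
        unfold poissonPMF
        positivity
      simp [bernoulliPMF, abs_of_nonneg h3]
  rw [dtv, h2.tsum_eq]
  ring

lemma strictMonoOn_mul_exp_neg :
    StrictMonoOn (fun l : ℝ => l * Real.exp (-l)) (Set.Ioc 0 1) := by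
  intro a ha b hb hab
  have h1 : a < b * Real.exp (a - b) := by
    have h2 := mul_lt_mul_of_pos_left (Real.add_one_lt_exp (sub_neg.2 hab).ne) hb.1
    nlinarith [hb.2]
  calc a * Real.exp (-a) < b * Real.exp (a - b) * Real.exp (-a) :=
        mul_lt_mul_of_pos_right h1 (Real.exp_pos _)
    _ = b * Real.exp (-b) := by
        rw [mul_assoc, ← Real.exp_add]
        congr 2
        ring

theorem stmt_1 (p : ℝ) (hp : p ∈ Set.Ioo (0 : ℝ) 1) :
    StrictAntiOn (fun l : ℝ => dtv (bernoulliPMF p) (poissonPMF l))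
      (Set.Ioc 0 (min (-Real.log (1 - p)) 1)) := by
  have key : ∀ l ∈ Set.Ioc 0 (min (-Real.log (1 - p)) 1),
      dtv (bernoulliPMF p) (poissonPMF l) = p - l * Real.exp (-l) := fun l hl =>
    dtv_bernoulliPMF_poissonPMF hl.1 <| (Real.log_le_iff_le_exp (sub_pos.2 hp.2)).1
      (le_neg_of_le_neg (hl.2.trans (min_le_left _ _)))
  intro a ha b hb hab
  simp only [key a ha, key b hb]
  exact sub_lt_sub_left (strictMonoOn_mul_exp_neg ⟨ha.1, ha.2.trans (min_le_right _ _)⟩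
    ⟨hb.1, hb.2.trans (min_le_right _ _)⟩ hab) p
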